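/- Let n ≥ 2, 1 < p < ∞, L ∈ ℕ with L ≥ 1, and let ω_1, …, ω_L ∈ S^{n-1} be pairwise distinct. Then there exist real numbers λ_1, …, λ_L such that the closed sets D̃_l := { ω ∈ S^{n-1} : −|ω − ω_l|^p − λ_l ≥ −|ω − ω_k|^p − λ_k for all 1 ≤ k ≤ L } (with |·| the Euclidean norm) satisfy: (i) the D̃_l cover S^{n-1}; (ii) σ_{n-1}(D̃_{l_1} ∩ D̃_{l_2}) = 0 whenever l_1 ≠ l_2; and (iii) σ_{n-1}(D̃_l) = 1/L for every 1 ≤ l ≤ L. -/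

import Mathlib

open MeasureTheory Metric Real Set
open scoped ENNReal NNReal

noncomputable section

/-- The unit sphere `S^{n-1}` in `ℝ^n`. -/
abbrev Sph (n : ℕ) := Metric.sphere (0 : EuclideanSpace ℝ (Fin n)) 1

/-- The normalized Riemannian (uniform) probability measure on the sphere,
realized as normalized `(n-1)`-dimensional Hausdorff measure. -/
def sphProb (n : ℕ) : Measure (Sph n) :=
  (μH[(n : ℝ) - 1] (Set.univ : Set (Sph n)))⁻¹ • μH[(n : ℝ) - 1]


lemma finrank_orth {n : ℕ} (hn : 2 ≤ n) (v : EuclideanSpace ℝ (Fin n)) (hv : ‖v‖ = 1) :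
    ((Module.finrank ℝ ((ℝ ∙ v)ᗮ : Submodule ℝ (EuclideanSpace ℝ (Fin n))) : ℕ) : ℝ) = (n:ℝ) - 1 := by
  have hv0 : v ≠ 0 := by rintro rfl; simp at hv
  have : Fact (Module.finrank ℝ (EuclideanSpace ℝ (Fin n)) = (n - 1) + 1) := ⟨by simp; omega⟩
  rw [Submodule.finrank_orthogonal_span_singleton (n := n - 1) hv0]
  push_cast [Nat.cast_sub (by omega : 1 ≤ n)]; ring

lemma hemi_lt_top {n : ℕ} (hn : 2 ≤ n) (v : EuclideanSpace ℝ (Fin n)) (hv : ‖v‖ = 1) :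
    μH[(n:ℝ) - 1] {x : EuclideanSpace ℝ (Fin n) | ‖x‖ = 1 ∧ inner ℝ v x ≤ 0} < ∞ := by
  have hd : (0:ℝ) ≤ (n:ℝ) - 1 := by
    have : (2:ℝ) ≤ n := by exact_mod_cast hn
    linarith
  let g : ((ℝ ∙ v)ᗮ : Submodule ℝ (EuclideanSpace ℝ (Fin n))) → EuclideanSpace ℝ (Fin n) :=
    fun w => stereoInvFunAux v w
  have hg : ContDiff ℝ 1 g := contDiff_stereoInvFunAux.comp ((ℝ ∙ v)ᗮ : Submodule ℝ (EuclideanSpace ℝ (Fin n))).subtypeL.contDiff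
  have hK : IsCompact (closedBall (0 : ((ℝ ∙ v)ᗮ : Submodule ℝ (EuclideanSpace ℝ (Fin n)))) 2) :=
    isCompact_closedBall _ _
  obtain ⟨K, hLip⟩ := (hg.locallyLipschitz.locallyLipschitzOn
    (s := closedBall (0 : ((ℝ ∙ v)ᗮ : Submodule ℝ (EuclideanSpace ℝ (Fin n)))) 2)).exists_lipschitzOnWith_of_compact hK
  have hsub : {x : EuclideanSpace ℝ (Fin n) | ‖x‖ = 1 ∧ inner ℝ v x ≤ 0} ⊆ g '' closedBall 0 2 := by
    rintro x ⟨hx, hvx⟩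
    have hxs : x ∈ sphere (0 : EuclideanSpace ℝ (Fin n)) 1 := by simp [hx]
    have hne : x ≠ v := by
      rintro rfl
      rw [real_inner_self_eq_norm_sq, hx] at hvx; norm_num at hvx
    refine ⟨stereoToFun v x, ?_, ?_⟩
    · rw [mem_closedBall_zero_iff, stereoToFun_apply, norm_smul]
      have h1 : ‖(ℝ ∙ v)ᗮ.orthogonalProjectionOnto x‖ ≤ 1 := by
        have := Submodule.norm_orthogonalProjectionOnto_apply_le (ℝ ∙ v)ᗮ x
        rwa [hx] at this
      have h2 : ‖2 / ((1:ℝ) - innerSL ℝ v x)‖ ≤ 2 := by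
        simp only [innerSL_apply_apply]
        rw [Real.norm_of_nonneg (by apply div_nonneg <;> linarith), div_le_iff₀ (by linarith)]
        linarith
      exact (mul_le_mul h2 h1 (norm_nonneg _) (by norm_num)).trans (by norm_num)
    · have := stereo_left_inv hv (x := ⟨x, hxs⟩) hne
      exact congrArg Subtype.val this
  refine (measure_mono hsub).trans_lt ((hLip.hausdorffMeasure_image_le hd).trans_lt ?_)
  refine ENNReal.mul_lt_top (ENNReal.rpow_lt_top_of_nonneg hd ENNReal.coe_ne_top) ?_
  rw [← finrank_orth hn v hv]
  exact hK.measure_lt_top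

lemma exists_unit {n : ℕ} (hn : 2 ≤ n) : ∃ v : EuclideanSpace ℝ (Fin n), ‖v‖ = 1 :=
  ⟨EuclideanSpace.single ⟨0, by omega⟩ 1, by simp⟩

lemma sphere_lt_top {n : ℕ} (hn : 2 ≤ n) :
    μH[(n:ℝ) - 1] (sphere (0 : EuclideanSpace ℝ (Fin n)) 1) < ∞ := by
  obtain ⟨v, hv⟩ := exists_unit hn
  have h : sphere (0 : EuclideanSpace ℝ (Fin n)) 1 ⊆
      {x : EuclideanSpace ℝ (Fin n) | ‖x‖ = 1 ∧ inner ℝ v x ≤ 0} ∪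
      {x : EuclideanSpace ℝ (Fin n) | ‖x‖ = 1 ∧ inner ℝ (-v) x ≤ 0} := by
    intro x hx
    have hx : ‖x‖ = 1 := by simpa using hx
    rcases le_total (inner ℝ v x) 0 with h | h
    · exact Or.inl ⟨hx, h⟩
    · exact Or.inr ⟨hx, by rw [inner_neg_left]; linarith⟩
  exact (measure_mono h).trans_lt (measure_union_lt_top (hemi_lt_top hn v hv)
    (hemi_lt_top hn (-v) (by simpa using hv)))

lemma sphere_pos {n : ℕ} (hn : 2 ≤ n) :
    μH[(n:ℝ) - 1] (sphere (0 : EuclideanSpace ℝ (Fin n)) 1) ≠ 0 := by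
  obtain ⟨v, hv⟩ := exists_unit hn
  have hd : (0:ℝ) ≤ (n:ℝ) - 1 := by
    have : (2:ℝ) ≤ n := by exact_mod_cast hn
    linarith
  intro h0
  have hL : LipschitzWith 1 ((ℝ ∙ v)ᗮ.orthogonalProjectionOnto) := by
    apply LipschitzWith.of_dist_le_mul
    intro x y
    rw [dist_eq_norm, dist_eq_norm, ← map_sub]
    simpa using Submodule.norm_orthogonalProjectionOnto_apply_le (ℝ ∙ v)ᗮ (x - y)
  have hi := (hL.lipschitzOnWith (s := sphere (0 : EuclideanSpace ℝ (Fin n)) 1)).hausdorffMeasure_image_le hd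
  rw [h0, mul_zero] at hi
  have hsub : ball (0 : ((ℝ ∙ v)ᗮ : Submodule ℝ (EuclideanSpace ℝ (Fin n)))) 1 ⊆
      (ℝ ∙ v)ᗮ.orthogonalProjectionOnto '' sphere (0 : EuclideanSpace ℝ (Fin n)) 1 := by
    intro w hw
    have hw : ‖w‖ < 1 := by simpa using hw
    have hwv : inner ℝ (w : EuclideanSpace ℝ (Fin n)) v = 0 :=
      Submodule.mem_orthogonal_singleton_iff_inner_left.1 w.2
    refine ⟨(w : EuclideanSpace ℝ (Fin n)) + √(1 - ‖w‖^2) • v, ?_, ?_⟩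
    · have h1 : ‖(w : EuclideanSpace ℝ (Fin n)) + √(1 - ‖w‖^2) • v‖ ^ 2 = 1 := by
        rw [norm_add_sq_real, inner_smul_right, hwv, norm_smul, hv, mul_one,
          Real.norm_of_nonneg (sqrt_nonneg _), Real.sq_sqrt (by nlinarith [norm_nonneg w])]
        simp
      rw [mem_sphere_zero_iff_norm]
      exact (pow_eq_one_iff_of_nonneg (norm_nonneg _) (by norm_num)).1 h1
    · rw [map_add, map_smul]
      have : (ℝ ∙ v)ᗮ.orthogonalProjectionOnto v = 0 := by
        rw [Submodule.orthogonalProjectionOnto_eq_zero_iff]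
        exact Submodule.le_orthogonal_orthogonal _ (Submodule.mem_span_singleton_self v)
      simp [this]
  have : μH[(n:ℝ) - 1] (ball (0 : ((ℝ ∙ v)ᗮ : Submodule ℝ (EuclideanSpace ℝ (Fin n)))) 1) = 0 :=
    le_antisymm ((measure_mono hsub).trans hi) bot_le
  rw [← finrank_orth hn v hv] at this
  exact (isOpen_ball.measure_pos _ ⟨0, by simp⟩).ne' this

/-- abstract semi-discrete transport -/
lemma semidiscrete {X : Type*} [MeasurableSpace X] [TopologicalSpace X] [BorelSpace X]
    [CompactSpace X]
    (μ : Measure X) [IsProbabilityMeasure μ] (L : ℕ) (hL : 1 ≤ L) (c : Fin L → X → ℝ)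
    (hc : ∀ l, Continuous (c l))
    (hnull : ∀ k l, k ≠ l → ∀ t : ℝ, μ {x | c k x - c l x = t} = 0) :
    ∃ lam : Fin L → ℝ, ∀ l, μ {x | ∀ k, c l x + lam l ≤ c k x + lam k} = 1 / L := by
  classical
  let C : Fin L → (Fin L → ℝ) → Set X := fun l lam => {x | ∀ k, c l x + lam l ≤ c k x + lam k}
  have hCdef : ∀ l lam x, x ∈ C l lam ↔ ∀ k, c l x + lam l ≤ c k x + lam k := fun _ _ _ => Iff.rfl
  have hCm : ∀ l lam, MeasurableSet (C l lam) := by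
    intro l lam
    apply IsClosed.measurableSet
    simp only [C, ofPred_forall]
    refine isClosed_iInter fun k => isClosed_le ?_ ?_
    · exact (hc l).add continuous_const
    · exact (hc k).add continuous_const
  let F : Fin L → (Fin L → ℝ) → ℝ := fun l lam => μ.real (C l lam)
  have hFc : ∀ l, Continuous (F l) := by
    intro l
    rw [continuous_iff_continuousAt]
    intro lam
    have := tendsto_measure_of_ae_tendsto_indicator (μ := μ) (nhds lam) (hCm l lam) (hCm l)
      MeasurableSet.univ (by simp) (Filter.Eventually.of_forall fun i => subset_univ _) ?_
    · exact (ENNReal.tendsto_toReal (measure_ne_top _ _)).comp this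
    have hae : ∀ᵐ x ∂μ, ∀ k, k ≠ l → c k x - c l x ≠ lam l - lam k := by
      rw [ae_all_iff]; intro k
      by_cases hk : k = l
      · simp [hk]
      · have := hnull k l hk (lam l - lam k)
        have h2 : ∀ᵐ x ∂μ, c k x - c l x ≠ lam l - lam k := by
          rw [ae_iff]; simpa using this
        filter_upwards [h2] with x hx _ using hx
    filter_upwards [hae] with x hx
    simp only [hCdef]
    have hev : ∀ k, ∀ᶠ i in nhds lam, (c l x + i l ≤ c k x + i k ↔ c l x + lam l ≤ c k x + lam k) := by
      intro k
      by_cases hk : k = l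
      · subst hk; simp
      have h1 : Continuous fun i : Fin L → ℝ => c l x + i l := by fun_prop
      have h2 : Continuous fun i : Fin L → ℝ => c k x + i k := by fun_prop
      rcases lt_trichotomy (c l x + lam l) (c k x + lam k) with h | h | h
      · filter_upwards [h1.continuousAt.eventually_lt h2.continuousAt h] with i hi
        exact ⟨fun _ => h.le, fun _ => hi.le⟩
      · exact absurd (by linarith) (hx k hk)
      · filter_upwards [h2.continuousAt.eventually_lt h1.continuousAt h] with i hi
        exact ⟨fun h' => absurd h' (not_le.2 hi), fun h' => absurd h' (not_le.2 h)⟩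
    filter_upwards [Filter.eventually_all.2 hev] with i hi
    exact forall_congr' hi
  have hsum : ∀ lam, ∑ l, F l lam = 1 := by
    intro lam
    have hU : (⋃ l, C l lam) = univ := by
      rw [eq_univ_iff_forall]; intro x
      have : Nonempty (Fin L) := ⟨⟨0, hL⟩⟩
      obtain ⟨l, hl⟩ := Finite.exists_min fun l => c l x + lam l
      exact mem_iUnion.2 ⟨l, hl⟩
    have := measure_iUnion₀ (μ := μ) (f := fun l => C l lam) ?_
      (fun l => (hCm l lam).nullMeasurableSet)
    · rw [hU, measure_univ, tsum_fintype] at this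
      simp only [F, measureReal_def]
      rw [← ENNReal.toReal_sum (fun _ _ => measure_ne_top _ _), ← this]
      simp
    · intro k l hkl
      refine measure_mono_null ?_ (hnull k l hkl (lam l - lam k))
      rintro x ⟨h1, h2⟩
      have := h1 l
      have := h2 k
      simp only [mem_ofPred_eq]; linarith
  obtain ⟨M, hM⟩ : ∃ M : ℝ, ∀ l x, |c l x| ≤ M := by
    have : ∀ l, ∃ M : ℝ, ∀ x, |c l x| ≤ M := by
      intro l
      obtain ⟨M, hM⟩ := isCompact_univ.exists_bound_of_continuousOn (hc l).continuousOn
      exact ⟨M, fun x => hM x (mem_univ _)⟩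
    choose M hM using this
    refine ⟨∑ l, |M l|, fun l x => (hM l x).trans ((le_abs_self _).trans ?_)⟩
    exact Finset.single_le_sum (f := fun l => |M l|) (fun _ _ => abs_nonneg _) (Finset.mem_univ l)
  have hM' : ∀ l x, -M ≤ c l x ∧ c l x ≤ M := fun l x => abs_le.1 (hM l x)
  have hM0 : 0 ≤ M := by
    have : Nonempty X := nonempty_of_isProbabilityMeasure μ
    exact (abs_nonneg _).trans (hM ⟨0, hL⟩ (Classical.arbitrary X))
  let z : Fin L := ⟨0, hL⟩
  have hLr : (0:ℝ) < L := by exact_mod_cast hL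
  let A : Set (Fin L → ℝ) := Icc (fun _ => -(2 * M + 1)) (fun _ => 2 * M + 1) ∩
    {lam | lam z = 0 ∧ ∀ l, l ≠ z → F l lam ≤ 1 / L}
  have hAc : IsCompact A := by
    apply isCompact_Icc.inter_right
    apply IsClosed.inter
    · exact isClosed_eq (continuous_apply z) continuous_const
    · have : {lam : Fin L → ℝ | ∀ l, l ≠ z → F l lam ≤ 1 / L} =
          ⋂ l, ⋂ (_ : l ≠ z), {lam | F l lam ≤ 1 / L} := by ext; simp
      change IsClosed {lam : Fin L → ℝ | ∀ l, l ≠ z → F l lam ≤ 1 / L}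
      rw [this]
      exact isClosed_iInter fun l => isClosed_iInter fun _ => isClosed_le (hFc l) continuous_const
  have hAne : A.Nonempty := by
    refine ⟨fun l => if l = z then 0 else 2 * M + 1, ⟨?_, ?_⟩, by simp, ?_⟩
    · intro l; by_cases h : l = z <;> simp [h] <;> linarith
    · intro l; by_cases h : l = z <;> simp [h] ; linarith
    · intro l hl
      have : C l (fun l => if l = z then 0 else 2 * M + 1) = ∅ := by
        rw [eq_empty_iff_forall_notMem]
        intro x hx
        have := hx z
        simp only [hl, if_true, if_false] at this
        linarith [hM' l x, hM' z x]
      simp only [F, this]; simp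
  obtain ⟨lam, hlA, hmin⟩ := hAc.exists_isMinOn hAne
    (f := fun lam : Fin L → ℝ => ∑ l, lam l) (by fun_prop)
  have hcard : ∑ l : Fin L, (1 / (L:ℝ)) = 1 := by
    simp; field_simp
  have hsplit : ∀ lam, F z lam = 1 / L + ∑ l ∈ Finset.univ.erase z, (1 / L - F l lam) := by
    intro lam
    have h1 := hsum lam
    rw [← Finset.add_sum_erase _ _ (Finset.mem_univ z)] at h1 hcard
    rw [Finset.sum_sub_distrib]; linarith
  have hz : 1 / (L:ℝ) ≤ F z lam := by
    rw [hsplit]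
    have : 0 ≤ ∑ l ∈ Finset.univ.erase z, (1 / L - F l lam) :=
      Finset.sum_nonneg fun l hl => by
        have := hlA.2.2 l (Finset.ne_of_mem_erase hl); linarith
    linarith
  have hlow : ∀ l, -(2 * M) ≤ lam l := by
    intro l
    have : (C z lam).Nonempty := by
      by_contra h
      rw [not_nonempty_iff_eq_empty] at h
      have : F z lam = 0 := by simp only [F, h]; simp
      have : (0:ℝ) < 1 / L := by positivity
      linarith
    obtain ⟨x, hx⟩ := this
    have := hx l
    rw [hlA.2.1] at this
    linarith [hM' l x, hM' z x]
  have hF : ∀ l, l ≠ z → F l lam = 1 / L := by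
    intro l hl
    by_contra hne
    have hlt : F l lam < 1 / L := lt_of_le_of_ne (hlA.2.2 l hl) hne
    let γ : ℝ → (Fin L → ℝ) := fun t => Function.update lam l (lam l - t)
    have hγ : Continuous γ := by
      refine Continuous.update continuous_const l (by fun_prop)
    have hγ0 : γ 0 = lam := by simp [γ]
    have hev : ∀ᶠ t in nhds (0:ℝ), F l (γ t) < 1 / L := by
      have : ContinuousAt (fun t => F l (γ t)) 0 := ((hFc l).comp hγ).continuousAt
      apply this.eventually_lt continuousAt_const
      simpa [hγ0] using hlt
    obtain ⟨ε, hε, hball⟩ := Metric.eventually_nhds_iff.1 hev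
    let t := min (ε / 2) 1
    have ht : 0 < t := lt_min (by linarith) one_pos
    have ht1 : t ≤ 1 := min_le_right _ _
    have htε : F l (γ t) < 1 / L := hball (by
      rw [Real.dist_eq, sub_zero, abs_of_pos ht]
      exact (min_le_left _ _).trans_lt (by linarith))
    have hle : γ t ≤ lam := by
      intro k
      by_cases hk : k = l
      · subst hk; simp [γ]; exact ht.le
      · simp [γ, hk]
    have hmem : γ t ∈ A := by
      refine ⟨⟨?_, hle.trans hlA.1.2⟩, ?_, ?_⟩
      · intro k
        by_cases hk : k = l
        · subst hk; simp [γ]; linarith [hlow k]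
        · simp [γ, hk]; linarith [hlow k]
      · simp [γ, hl.symm, hlA.2.1]
      · intro k hk
        by_cases hkl : k = l
        · subst hkl; exact htε.le
        · refine le_trans (measureReal_mono ?_ (measure_ne_top _ _)) (hlA.2.2 k hk)
          intro x hx j
          have := hx j
          have h2 := hle j
          have h3 : γ t k = lam k := by simp [γ, hkl]
          rw [h3] at this
          linarith
    have h1 := hmin hmem
    simp only [mem_ofPred_eq] at h1
    have h2 : ∑ k, γ t k < ∑ k, lam k := by
      refine Finset.sum_lt_sum (fun k _ => hle k) ⟨l, Finset.mem_univ _, ?_⟩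
      simp [γ]; exact ht
    linarith
  have hFall : ∀ l, F l lam = 1 / L := by
    intro l
    by_cases hl : l = z
    · rw [hl, hsplit, Finset.sum_eq_zero]; · simp
      intro k hk
      rw [hF k (Finset.ne_of_mem_erase hk), sub_self]
    · exact hF l hl
  refine ⟨lam, fun l => ?_⟩
  have h := hFall l
  have h2 : μ (C l lam) = ENNReal.ofReal (F l lam) := by
    simp [F]
  change μ (C l lam) = _
  rw [h2, h, ENNReal.ofReal_div_of_pos hLr]; simp

lemma analytic_level_null (h : ℝ → ℝ) (hc : Continuous h) (u v z w c : ℝ)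
    (ha : AnalyticOnNhd ℝ h (Ioo u v)) (hz : z ∈ Ioo u v) (hz0 : h z = 0)
    (hw : w ∈ Icc u v) (hw0 : h w ≠ 0) :
    volume ({φ | h φ = c} ∩ Ioo u v) = 0 := by
  have huv : u < v := hz.1.trans hz.2
  rcases ha.eqOn_or_eventually_ne_of_preconnected (g := fun _ => c) analyticOnNhd_const
    isPreconnected_Ioo with h1 | h1
  · exfalso
    have hcl : EqOn h (fun _ => c) (closure (Ioo u v)) := h1.closure hc continuous_const
    rw [closure_Ioo huv.ne] at hcl
    have := hcl (Ioo_subset_Icc_self hz)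
    have h2 := hcl hw
    simp only at this h2
    exact hw0 (by rw [h2, ← this, hz0])
  · have := ae_restrict_le_codiscreteWithin (μ := volume) (measurableSet_Ioo (a := u) (b := v)) h1
    rw [← Filter.eventually_iff, ae_iff] at this
    rw [← Measure.restrict_apply' measurableSet_Ioo]
    simpa using this

lemma cos_pos_aux {r t : ℝ} (hr : 0 < r) (hr1 : r ≤ 1) (h1 : -(2*π) < t) (h2 : t < 2*π) (h3 : t ≠ 0) :
    0 < 2 - 2 * (r * cos t) := by
  have hlt : cos t < 1 := by
    refine lt_of_le_of_ne (cos_le_one t) fun h => h3 ?_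
    exact (cos_eq_one_iff_of_lt_of_lt h1 h2).1 h
  nlinarith

lemma circle_null (r α q c : ℝ) (hr : 0 < r) (hr1 : r ≤ 1) (hα : 0 < α) (hαπ : α < π) (hq : 0 < q) :
    volume {φ : ℝ | (2 - 2 * (r * cos (φ - α))) ^ q - (2 - 2 * (r * cos (φ + α))) ^ q = c} = 0 := by
  set h : ℝ → ℝ := fun φ => (2 - 2 * (r * cos (φ - α))) ^ q - (2 - 2 * (r * cos (φ + α))) ^ q with hh
  have hc : Continuous h := by
    refine Continuous.sub ?_ ?_
    · exact Continuous.rpow_const (by fun_prop) fun _ => Or.inr hq.le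
    · exact Continuous.rpow_const (by fun_prop) fun _ => Or.inr hq.le
  have han : ∀ φ, 0 < 2 - 2 * (r * cos (φ - α)) → 0 < 2 - 2 * (r * cos (φ + α)) →
      AnalyticAt ℝ h φ := by
    intro φ h1 h2
    have a1 : AnalyticAt ℝ (fun φ : ℝ => 2 - 2 * (r * cos (φ - α))) φ := by fun_prop
    have a2 : AnalyticAt ℝ (fun φ : ℝ => 2 - 2 * (r * cos (φ + α))) φ := by fun_prop
    have b1 : AnalyticAt ℝ (fun y : ℝ => y ^ q) (2 - 2 * (r * cos (φ - α))) :=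
      (contDiffAt_rpow_const_of_ne (n := ⊤) h1.ne').analyticAt
    have b2 : AnalyticAt ℝ (fun y : ℝ => y ^ q) (2 - 2 * (r * cos (φ + α))) :=
      (contDiffAt_rpow_const_of_ne (n := ⊤) h2.ne').analyticAt
    exact (AnalyticAt.comp (f := fun φ : ℝ => 2 - 2 * (r * cos (φ - α))) b1 a1).sub
      (AnalyticAt.comp (f := fun φ : ℝ => 2 - 2 * (r * cos (φ + α))) b2 a2)
  have h0 : h 0 = 0 := by simp [hh]
  have hπ : h π = 0 := by
    have : cos (π - α) = cos (π + α) := by rw [cos_pi_sub, add_comm, cos_add_pi]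
    simp [hh, this]
  have hhα : h α ≠ 0 := by
    intro h1
    have h2 : (2 - 2 * (r * cos (α - α))) ^ q = (2 - 2 * (r * cos (α + α))) ^ q := by
      simpa [hh, sub_eq_zero] using h1
    have b : ∀ t, 0 ≤ 2 - 2 * (r * cos t) := fun t => by nlinarith [cos_le_one t]
    have h3 := (Real.rpow_left_inj (b _) (b _) hq.ne').1 h2
    have h4 := cos_pos_aux (t := 2 * α) one_pos le_rfl (by linarith) (by linarith) (by linarith)
    rw [sub_self, cos_zero, ← two_mul] at h3
    nlinarith
  have n1 : volume ({φ | h φ = c} ∩ Ioo (-α) α) = 0 := by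
    apply analytic_level_null h hc (-α) α 0 α c _ ⟨by linarith, hα⟩ h0 ⟨by linarith, le_rfl⟩ hhα
    intro φ hφ
    apply han
    · exact cos_pos_aux hr hr1 (by linarith [hφ.1]) (by linarith [hφ.2]) (by linarith [hφ.2])
    · exact cos_pos_aux hr hr1 (by linarith [hφ.1]) (by linarith [hφ.2]) (by linarith [hφ.1])
  have n2 : volume ({φ | h φ = c} ∩ Ioo α (2*π-α)) = 0 := by
    apply analytic_level_null h hc α (2*π-α) π α c _ ⟨by linarith, by linarith⟩ hπ ⟨le_rfl, by linarith⟩ hhα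
    intro φ hφ
    apply han
    · exact cos_pos_aux hr hr1 (by linarith [hφ.1]) (by linarith [hφ.2]) (by linarith [hφ.1])
    · exact cos_pos_aux hr hr1 (by linarith [hφ.1]) (by linarith [hφ.2]) (by linarith [hφ.1])
  have n3 : volume ({φ | h φ = c} ∩ Ico (-α) (-α + 2*π)) = 0 := by
    refine measure_mono_null (t := ({φ | h φ = c} ∩ Ioo (-α) α) ∪ ({φ | h φ = c} ∩ Ioo α (2*π-α)) ∪ {-α, α}) ?_ ?_
    · rintro φ ⟨h1, h2, h3⟩
      rcases eq_or_lt_of_le h2 with h4 | h4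
      · right; left; exact h4.symm
      rcases lt_trichotomy φ α with h5 | h5 | h5
      · left; left; exact ⟨h1, h4, h5⟩
      · right; right; exact h5
      · left; right; exact ⟨h1, h5, by linarith⟩
    · rw [measure_union_null_iff, measure_union_null_iff]
      exact ⟨⟨n1, n2⟩, (Set.toFinite _).measure_zero _⟩
  have hper : ∀ (m : ℤ) φ, h (φ + m * (2*π)) = h φ := by
    intro m φ
    have e1 : φ + m * (2*π) - α = (φ - α) + m * (2*π) := by ring
    have e2 : φ + m * (2*π) + α = (φ + α) + m * (2*π) := by ring
    simp only [hh, e1, e2, cos_add_int_mul_two_pi]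
  refine measure_mono_null (t := ⋃ m : ℤ, (fun φ => φ + m * (2*π)) ⁻¹' ({φ | h φ = c} ∩ Ico (-α) (-α + 2*π))) ?_ ?_
  · intro φ hφ
    obtain ⟨m, hm, -⟩ := existsUnique_add_zsmul_mem_Ico (two_pi_pos) φ (-α)
    refine mem_iUnion.2 ⟨m, ?_, ?_⟩
    · show h _ = c
      rw [hper]; exact hφ
    · simpa using hm
  · rw [measure_iUnion_null_iff]
    intro m
    rw [measure_preimage_add_right, n3]

lemma frame {n : ℕ} (hn : 2 ≤ n) (a b : EuclideanSpace ℝ (Fin n)) (ha : ‖a‖ = 1) (hb : ‖b‖ = 1)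
    (hab : a ≠ b) : ∃ (e f : EuclideanSpace ℝ (Fin n)) (α : ℝ), ‖e‖ = 1 ∧ ‖f‖ = 1 ∧
      inner ℝ e f = 0 ∧ 0 < α ∧ α < π ∧ a = cos α • e + sin α • f ∧ b = cos α • e - sin α • f := by
  have hab0 : a - b ≠ 0 := sub_ne_zero.2 hab
  have hpos : 0 < ‖a - b‖ := norm_pos_iff.2 hab0
  let f := ‖a - b‖⁻¹ • (a - b)
  have hf : ‖f‖ = 1 := by simp [f, norm_smul, hpos.ne']
  have hfab : a - b = ‖a - b‖ • f := by simp [f, smul_smul, hpos.ne']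
  have horth : inner ℝ (a + b) (a - b) = 0 := by
    rw [inner_add_left, inner_sub_right, inner_sub_right, real_inner_self_eq_norm_sq,
      real_inner_self_eq_norm_sq, ha, hb, real_inner_comm]; ring
  obtain ⟨e, κ, he, hef, hsum⟩ : ∃ (e : EuclideanSpace ℝ (Fin n)) (κ : ℝ), ‖e‖ = 1 ∧
      inner ℝ e f = 0 ∧ a + b = (2 * κ) • e := by
    by_cases h : a + b = 0
    · have hfr := finrank_orth hn f hf
      have : 0 < Module.finrank ℝ ((ℝ ∙ f)ᗮ : Submodule ℝ (EuclideanSpace ℝ (Fin n))) := by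
        have h2 : (2:ℝ) ≤ n := by exact_mod_cast hn
        have : (0:ℝ) < Module.finrank ℝ ((ℝ ∙ f)ᗮ : Submodule ℝ (EuclideanSpace ℝ (Fin n))) := by
          rw [hfr]; linarith
        exact_mod_cast this
      have := Module.finrank_pos_iff_exists_ne_zero.1 this
      obtain ⟨w, hw⟩ := this
      have hw' : ‖w‖ ≠ 0 := norm_ne_zero_iff.2 hw
      have hwn : ‖(w : EuclideanSpace ℝ (Fin n))‖ ≠ 0 := hw'
      refine ⟨‖(w : EuclideanSpace ℝ (Fin n))‖⁻¹ • (w : EuclideanSpace ℝ (Fin n)), 0, ?_, ?_, by simp [h]⟩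
      · rw [norm_smul, norm_inv, norm_norm, inv_mul_cancel₀ hwn]
      · rw [inner_smul_left, Submodule.mem_orthogonal_singleton_iff_inner_left.1 w.2, mul_zero]
    · have hp2 : ‖a + b‖ ≠ 0 := norm_ne_zero_iff.2 h
      refine ⟨‖a + b‖⁻¹ • (a + b), ‖a + b‖ / 2, ?_, ?_, ?_⟩
      · rw [norm_smul, norm_inv, norm_norm, inv_mul_cancel₀ hp2]
      · simp only [f]
        rw [inner_smul_left, inner_smul_right, horth]; simp
      · rw [smul_smul, mul_div_cancel₀ _ (two_ne_zero), mul_inv_cancel₀ hp2, one_smul]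
  set ρ := ‖a - b‖ / 2 with hρ
  have hρ0 : 0 < ρ := by positivity
  have hfab' : a - b = (2 * ρ) • f := by rw [hfab]; congr 1; rw [hρ]; ring
  have ea : a = κ • e + ρ • f := by
    have : (2:ℝ) • a = (2:ℝ) • (κ • e + ρ • f) := by
      calc (2:ℝ) • a = (a + b) + (a - b) := by module
        _ = _ := by rw [hsum, hfab']; module
    exact smul_right_injective _ (two_ne_zero' ℝ) this
  have eb : b = κ • e - ρ • f := by
    have : (2:ℝ) • b = (2:ℝ) • (κ • e - ρ • f) := by
      calc (2:ℝ) • b = (a + b) - (a - b) := by module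
        _ = _ := by rw [hsum, hfab']; module
    exact smul_right_injective _ (two_ne_zero' ℝ) this
  have hnorm : κ ^ 2 + ρ ^ 2 = 1 := by
    have h1 : ‖a‖ ^ 2 = κ ^ 2 + ρ ^ 2 := by
      rw [ea, norm_add_sq_real, inner_smul_left, inner_smul_right, hef, norm_smul, norm_smul, he, hf]
      simp
    rw [← h1, ha]; norm_num
  have hκ1 : -1 < κ := by nlinarith
  have hκ2 : κ < 1 := by nlinarith
  refine ⟨e, f, arccos κ, he, hf, hef, arccos_pos.2 hκ2, ?_, ?_, ?_⟩
  · refine lt_of_le_of_ne (arccos_le_pi _) fun h => ?_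
    rw [arccos_eq_pi] at h; linarith
  all_goals
    rw [cos_arccos hκ1.le hκ2.le, sin_arccos, show 1 - κ ^ 2 = ρ ^ 2 by linarith, sqrt_sq hρ0.le]
    assumption

section rot
variable {n : ℕ}

/-- rotation in the plane spanned by `e, f` -/
def rot (e f : EuclideanSpace ℝ (Fin n)) (θ : ℝ) (x : EuclideanSpace ℝ (Fin n)) :
    EuclideanSpace ℝ (Fin n) :=
  x + ((cos θ - 1) * inner ℝ e x - sin θ * inner ℝ f x) • e
    + (sin θ * inner ℝ e x + (cos θ - 1) * inner ℝ f x) • f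

variable {e f : EuclideanSpace ℝ (Fin n)}

lemma inner_rot_e (he : ‖e‖ = 1) (hef : inner ℝ e f = 0) (θ : ℝ)
    (x : EuclideanSpace ℝ (Fin n)) :
    inner ℝ e (rot e f θ x) = cos θ * inner ℝ e x - sin θ * inner ℝ f x := by
  simp only [rot, inner_add_right, inner_smul_right, hef, real_inner_self_eq_norm_sq, he]; ring

lemma inner_rot_f (hf : ‖f‖ = 1) (hef : inner ℝ e f = 0) (θ : ℝ)
    (x : EuclideanSpace ℝ (Fin n)) :
    inner ℝ f (rot e f θ x) = sin θ * inner ℝ e x + cos θ * inner ℝ f x := by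
  have hfe : inner ℝ f e = 0 := by rw [real_inner_comm]; exact hef
  simp only [rot, inner_add_right, inner_smul_right, hfe, real_inner_self_eq_norm_sq, hf]; ring

lemma rot_rot (he : ‖e‖ = 1) (hf : ‖f‖ = 1) (hef : inner ℝ e f = 0) (θ : ℝ)
    (x : EuclideanSpace ℝ (Fin n)) : rot e f θ (rot e f (-θ) x) = x := by
  rw [rot, inner_rot_e he hef, inner_rot_f hf hef, rot, cos_neg, sin_neg]
  have h := sin_sq_add_cos_sq θ
  generalize sin θ = s at *
  generalize cos θ = c at *
  match_scalars
  · ring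
  · linear_combination (inner ℝ e x) * h
  · linear_combination (inner ℝ f x) * h

lemma norm_rot (he : ‖e‖ = 1) (hf : ‖f‖ = 1) (hef : inner ℝ e f = 0) (θ : ℝ)
    (x : EuclideanSpace ℝ (Fin n)) : ‖rot e f θ x‖ = ‖x‖ := by
  have h2 : ‖rot e f θ x‖ ^ 2 = ‖x‖ ^ 2 := by
    rw [← real_inner_self_eq_norm_sq, ← real_inner_self_eq_norm_sq x]
    have key : ∀ y, inner ℝ (rot e f θ x) y = inner ℝ x y
        + ((cos θ - 1) * inner ℝ e x - sin θ * inner ℝ f x) * inner ℝ e y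
        + (sin θ * inner ℝ e x + (cos θ - 1) * inner ℝ f x) * inner ℝ f y := by
      intro y
      simp only [rot, inner_add_left, inner_smul_left, conj_trivial]
    rw [key, inner_rot_e he hef, inner_rot_f hf hef, rot, inner_add_right, inner_add_right, inner_smul_right, inner_smul_right,
      real_inner_comm e x, real_inner_comm f x]
    have h := sin_sq_add_cos_sq θ
    generalize sin θ = s at *
    generalize cos θ = c at *
    linear_combination ((inner ℝ e x)^2 + (inner ℝ f x)^2) * h
  exact (sq_eq_sq₀ (norm_nonneg _) (norm_nonneg _)).1 h2

lemma rot_sub (θ : ℝ) (x y : EuclideanSpace ℝ (Fin n)) :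
    rot e f θ x - rot e f θ y = rot e f θ (x - y) := by
  simp only [rot, inner_sub_right]
  module

lemma rot_preimage (he : ‖e‖ = 1) (hf : ‖f‖ = 1) (hef : inner ℝ e f = 0) (θ d : ℝ)
    (A : Set (EuclideanSpace ℝ (Fin n))) : μH[d] (rot e f θ ⁻¹' A) = μH[d] A := by
  have hi : Isometry (rot e f θ) := by
    apply Isometry.of_dist_eq
    intro x y
    rw [dist_eq_norm, dist_eq_norm, rot_sub, norm_rot he hf hef]
  have hs : Function.Surjective (rot e f θ) := fun x => ⟨_, rot_rot he hf hef θ x⟩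
  rw [hi.hausdorffMeasure_preimage (Or.inr hs), hs.range_eq, inter_univ]

lemma codim_two_null (hn : 2 ≤ n) (he : ‖e‖ = 1) (hf : ‖f‖ = 1) (hef : inner ℝ e f = 0) :
    μH[(n:ℝ) - 1] {x : EuclideanSpace ℝ (Fin n) | inner ℝ e x = 0 ∧ inner ℝ f x = 0} = 0 := by
  have ho : Orthonormal ℝ ![e, f] := by
    rw [orthonormal_vecCons_iff]
    refine ⟨he, ?_, ?_⟩
    · intro i; fin_cases i; simpa using hef
    · rw [orthonormal_vecCons_iff]
      refine ⟨hf, ?_, ?_⟩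
      · intro i; exact i.elim0
      · constructor <;> intro i <;> exact i.elim0
  let K : Submodule ℝ (EuclideanSpace ℝ (Fin n)) := (Submodule.span ℝ (Set.range ![e, f]))ᗮ
  have h1 : Module.finrank ℝ (Submodule.span ℝ (Set.range ![e, f])) = 2 := by
    rw [finrank_span_eq_card ho.linearIndependent]; simp
  have h2 := Submodule.finrank_add_finrank_orthogonal (Submodule.span ℝ (Set.range ![e, f]))
  have h3 : Module.finrank ℝ K + 2 = n := by
    rw [h1] at h2; simp at h2; simp only [K]; omega
  have hsub : {x : EuclideanSpace ℝ (Fin n) | inner ℝ e x = 0 ∧ inner ℝ f x = 0} ⊆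
      Subtype.val '' (univ : Set K) := by
    rintro x ⟨hx1, hx2⟩
    refine ⟨⟨x, ?_⟩, mem_univ _, rfl⟩
    simp only [K]
    rw [Submodule.mem_orthogonal]
    intro u hu
    induction hu using Submodule.span_induction with
    | mem y hy =>
      obtain ⟨i, rfl⟩ := hy
      fin_cases i
      · simpa using hx1
      · simpa using hx2
    | zero => simp
    | add y z _ _ h1 h2 => rw [inner_add_left, h1, h2, add_zero]
    | smul c y _ h1 => rw [inner_smul_left, h1, mul_zero]
  refine measure_mono_null hsub ?_
  have hd' : (n:ℝ) - 1 = (((n - 1 : ℕ) : ℝ≥0) : ℝ) := by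
    rw [NNReal.coe_natCast, Nat.cast_sub (by omega : 1 ≤ n)]; simp
  rw [isometry_subtype_coe.hausdorffMeasure_image (Or.inl (by rw [hd']; positivity)), hd']
  apply hausdorffMeasure_of_dimH_lt
  rw [Real.dimH_univ_eq_finrank]
  have : Module.finrank ℝ K < n - 1 := by omega
  exact_mod_cast this

lemma continuous_rot : Continuous fun q : EuclideanSpace ℝ (Fin n) × ℝ => rot e f q.2 q.1 := by
  unfold rot; fun_prop

lemma norm_rpow_eq (x a : EuclideanSpace ℝ (Fin n)) (hx : ‖x‖ = 1) (ha : ‖a‖ = 1) (p : ℝ) :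
    ‖x - a‖ ^ p = (2 - 2 * inner ℝ x a) ^ (p / 2) := by
  have : 2 - 2 * inner ℝ x a = ‖x - a‖ ^ (2:ℝ) := by
    rw [Real.rpow_two, norm_sub_sq_real, hx, ha]; ring
  rw [this, ← Real.rpow_mul (norm_nonneg _)]
  congr 1; ring

end rot

lemma level_null {n : ℕ} (hn : 2 ≤ n) (p : ℝ) (hp : 0 < p) (a b : EuclideanSpace ℝ (Fin n))
    (ha : ‖a‖ = 1) (hb : ‖b‖ = 1) (hab : a ≠ b) (c : ℝ) :
    μH[(n:ℝ) - 1] {x : EuclideanSpace ℝ (Fin n) | ‖x‖ = 1 ∧ ‖x - a‖ ^ p - ‖x - b‖ ^ p = c} = 0 := by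
  obtain ⟨e, f, α, he, hf, hef, hα, hαπ, ea, eb⟩ := frame hn a b ha hb hab
  set A : Set (EuclideanSpace ℝ (Fin n)) := {x | ‖x‖ = 1 ∧ ‖x - a‖ ^ p - ‖x - b‖ ^ p = c} with hA
  have hAcl : IsClosed A := by
    apply IsClosed.inter
    · exact isClosed_eq continuous_norm continuous_const
    · refine isClosed_eq (Continuous.sub ?_ ?_) continuous_const
      · exact Continuous.rpow_const (by fun_prop) fun _ => Or.inr hp.le
      · exact Continuous.rpow_const (by fun_prop) fun _ => Or.inr hp.le
  let ν : Measure (EuclideanSpace ℝ (Fin n)) :=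
    (μH[(n:ℝ) - 1]).restrict (sphere (0 : EuclideanSpace ℝ (Fin n)) 1)
  have : IsFiniteMeasure ν := ⟨by simpa [ν] using sphere_lt_top hn⟩
  let B : Set (EuclideanSpace ℝ (Fin n) × ℝ) := (fun q => rot e f q.2 q.1) ⁻¹' A
  have hB : MeasurableSet B := (hAcl.preimage continuous_rot).measurableSet
  have hB0 : (ν.prod volume) B = 0 := by
    rw [Measure.measure_prod_null hB]
    have h1 : ∀ᵐ x ∂ν, ‖x‖ = 1 := by
      filter_upwards [ae_restrict_mem (isClosed_sphere.measurableSet)] with x hx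
      simpa using hx
    have h2 : ∀ᵐ x ∂ν, ¬ (inner ℝ e x = 0 ∧ inner ℝ f x = 0) := by
      apply ae_restrict_of_ae
      rw [ae_iff]
      simpa using codim_two_null hn he hf hef
    filter_upwards [h1, h2] with x hx hx2
    let w : ℂ := ⟨inner ℝ e x, inner ℝ f x⟩
    have hw : w ≠ 0 := by
      intro h; exact hx2 ⟨congrArg Complex.re h, congrArg Complex.im h⟩
    have hr : 0 < ‖w‖ := norm_pos_iff.2 hw
    have hwe : inner ℝ e x = ‖w‖ * cos w.arg := (Complex.norm_mul_cos_arg w).symm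
    have hwf : inner ℝ f x = ‖w‖ * sin w.arg := (Complex.norm_mul_sin_arg w).symm
    have hr1 : ‖w‖ ≤ 1 := by
      have h3 : ‖x - inner ℝ e x • e - inner ℝ f x • f‖ ^ 2 = ‖x‖ ^ 2 - (inner ℝ e x ^ 2 + inner ℝ f x ^ 2) := by
        have hfe : inner ℝ f e = 0 := by rw [real_inner_comm]; exact hef
        rw [← real_inner_self_eq_norm_sq, ← real_inner_self_eq_norm_sq]
        simp only [inner_sub_left, inner_sub_right, inner_smul_left, inner_smul_right, hef, hfe,
          real_inner_self_eq_norm_sq, he, hf, real_inner_comm x e, real_inner_comm x f, conj_trivial]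
        ring
      have h4 : ‖w‖ ^ 2 = inner ℝ e x ^ 2 + inner ℝ f x ^ 2 := by
        rw [Complex.sq_norm, Complex.normSq_apply]; simp only [w]; ring
      rw [hx, ← h4] at h3
      nlinarith [sq_nonneg ‖x - inner ℝ e x • e - inner ℝ f x • f‖]
    have hc := circle_null ‖w‖ α (p / 2) c hr hr1 hα hαπ (by linarith)
    rw [← measure_preimage_add_right volume w.arg] at hc
    refine measure_mono_null ?_ hc
    intro θ hθ
    have hθ' : rot e f θ x ∈ A := hθ
    obtain ⟨h5, h6⟩ := hθ'
    rw [norm_rpow_eq _ _ h5 ha, norm_rpow_eq _ _ h5 hb] at h6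
    have i1 : inner ℝ (rot e f θ x) a = ‖w‖ * cos (θ + w.arg - α) := by
      rw [real_inner_comm, ea, inner_add_left, inner_smul_left, inner_smul_left,
        inner_rot_e he hef, inner_rot_f hf hef, hwe, hwf, cos_sub, cos_add, sin_add]
      simp only [conj_trivial]; ring
    have i2 : inner ℝ (rot e f θ x) b = ‖w‖ * cos (θ + w.arg + α) := by
      rw [real_inner_comm, eb, inner_sub_left, inner_smul_left, inner_smul_left,
        inner_rot_e he hef, inner_rot_f hf hef, hwe, hwf, cos_add (θ + w.arg), cos_add, sin_add]
      simp only [conj_trivial]; ring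
    rw [i1, i2] at h6
    exact h6
  have hae := Measure.ae_ae_of_ae_prod (μ := volume) (ν := ν) (p := fun q => (q.2, q.1) ∉ B) (by
    have h := (Measure.measurePreserving_swap (μ := (volume : Measure ℝ)) (ν := ν)).quasiMeasurePreserving
    have h2 : ∀ᵐ q ∂(ν.prod (volume : Measure ℝ)), q ∉ B := by rw [ae_iff]; simpa using hB0
    exact h.ae h2)
  obtain ⟨θ, hθ⟩ := hae.exists
  have hθ0 : ν (rot e f θ ⁻¹' A) = 0 := by
    rw [ae_iff] at hθ
    simp only [B, mem_preimage, not_not] at hθ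
    exact hθ
  rw [Measure.restrict_apply' isClosed_sphere.measurableSet, inter_eq_left.2, rot_preimage he hf hef] at hθ0
  · exact hθ0
  · intro x hx
    have := hx.1
    rw [norm_rot he hf hef] at this
    simpa using this

lemma sph_measure_eq {n : ℕ} (hn : 2 ≤ n) (s : Set (Sph n)) :
    μH[(n:ℝ) - 1] s = μH[(n:ℝ) - 1] (Subtype.val '' s : Set (EuclideanSpace ℝ (Fin n))) := by
  have hd : (0:ℝ) ≤ (n:ℝ) - 1 := by
    have : (2:ℝ) ≤ n := by exact_mod_cast hn
    linarith
  rw [isometry_subtype_coe.hausdorffMeasure_image (Or.inl hd)]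

lemma sphProb_isProb {n : ℕ} (hn : 2 ≤ n) : IsProbabilityMeasure (sphProb n) := by
  constructor
  have hu : μH[(n:ℝ) - 1] (univ : Set (Sph n)) =
      μH[(n:ℝ) - 1] (sphere (0 : EuclideanSpace ℝ (Fin n)) 1) := by
    rw [sph_measure_eq hn, image_univ, Subtype.range_coe_subtype]; rfl
  rw [sphProb, Measure.smul_apply, smul_eq_mul]
  apply ENNReal.inv_mul_cancel
  · rw [hu]; exact sphere_pos hn
  · rw [hu]; exact (sphere_lt_top hn).ne

lemma sphProb_level_null {n : ℕ} (hn : 2 ≤ n) (p : ℝ) (hp : 0 < p) (a b : Sph n)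
    (hab : a ≠ b) (c : ℝ) :
    sphProb n {x : Sph n | ‖(x : EuclideanSpace ℝ (Fin n)) - a‖ ^ p
      - ‖(x : EuclideanSpace ℝ (Fin n)) - b‖ ^ p = c} = 0 := by
  rw [sphProb, Measure.smul_apply, smul_eq_mul]
  refine mul_eq_zero_of_right _ ?_
  rw [sph_measure_eq hn]
  refine measure_mono_null ?_ (level_null hn p hp a b (by simpa using a.2) (by simpa using b.2)
    (fun h => hab (Subtype.ext h)) c)
  rintro _ ⟨x, hx, rfl⟩
  exact ⟨by simpa using x.2, hx⟩

/-- For pairwise distinct points `ω_1, …, ω_L ∈ S^{n-1}` there are constants `λ_1, …, λ_L`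
such that the "Laguerre cells"
`D̃_l = {ω ∈ S^{n-1} : -|ω - ω_l|^p - λ_l ≥ -|ω - ω_k|^p - λ_k for all k}`
cover the sphere, have pairwise `σ_{n-1}`-null intersections, and each has measure `1/L`. -/
theorem laguerre_cells_equal_area (n : ℕ) (hn : 2 ≤ n) (p : ℝ) (hp : 1 < p)
    (L : ℕ) (hL : 1 ≤ L) (ω : Fin L → Sph n) (hω : Function.Injective ω) :
    ∃ lam : Fin L → ℝ,
      (⋃ l, {x : Sph n | ∀ k,
          -‖(x : EuclideanSpace ℝ (Fin n)) - (ω k : EuclideanSpace ℝ (Fin n))‖ ^ p - lam k ≤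
          -‖(x : EuclideanSpace ℝ (Fin n)) - (ω l : EuclideanSpace ℝ (Fin n))‖ ^ p - lam l}) =
        Set.univ ∧
      (∀ l₁ l₂ : Fin L, l₁ ≠ l₂ →
        sphProb n ({x : Sph n | ∀ k,
            -‖(x : EuclideanSpace ℝ (Fin n)) - (ω k : EuclideanSpace ℝ (Fin n))‖ ^ p - lam k ≤
            -‖(x : EuclideanSpace ℝ (Fin n)) - (ω l₁ : EuclideanSpace ℝ (Fin n))‖ ^ p - lam l₁} ∩
          {x : Sph n | ∀ k,
            -‖(x : EuclideanSpace ℝ (Fin n)) - (ω k : EuclideanSpace ℝ (Fin n))‖ ^ p - lam k ≤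
            -‖(x : EuclideanSpace ℝ (Fin n)) - (ω l₂ : EuclideanSpace ℝ (Fin n))‖ ^ p - lam l₂}) =
          0) ∧
      (∀ l : Fin L,
        sphProb n {x : Sph n | ∀ k,
            -‖(x : EuclideanSpace ℝ (Fin n)) - (ω k : EuclideanSpace ℝ (Fin n))‖ ^ p - lam k ≤
            -‖(x : EuclideanSpace ℝ (Fin n)) - (ω l : EuclideanSpace ℝ (Fin n))‖ ^ p - lam l} =
          1 / L) := by
  have hp0 : 0 < p := by linarith
  have := sphProb_isProb hn
  have hnull : ∀ k l, k ≠ l → ∀ t : ℝ,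
      sphProb n {x : Sph n | ‖(x : EuclideanSpace ℝ (Fin n)) - ω k‖ ^ p
        - ‖(x : EuclideanSpace ℝ (Fin n)) - ω l‖ ^ p = t} = 0 := fun k l hkl t =>
    sphProb_level_null hn p hp0 (ω k) (ω l) (fun h => hkl (hω h)) t
  obtain ⟨lam, hlam⟩ := semidiscrete (sphProb n) L hL
    (fun k x => ‖(x : EuclideanSpace ℝ (Fin n)) - ω k‖ ^ p)
    (fun k => Continuous.rpow_const (by fun_prop) fun _ => Or.inr hp0.le) hnull
  refine ⟨lam, ?_, ?_, ?_⟩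
  · rw [eq_univ_iff_forall]
    intro x
    have : Nonempty (Fin L) := ⟨⟨0, hL⟩⟩
    obtain ⟨l, hl⟩ := Finite.exists_max fun l =>
      -‖(x : EuclideanSpace ℝ (Fin n)) - (ω l : EuclideanSpace ℝ (Fin n))‖ ^ p - lam l
    exact mem_iUnion.2 ⟨l, hl⟩
  · intro k l hkl
    refine measure_mono_null ?_ (hnull k l hkl (lam l - lam k))
    rintro x ⟨h1, h2⟩
    have := h1 l
    have := h2 k
    simp only [mem_ofPred_eq]; linarith
  · intro l
    rw [← hlam l]
    congr 1
    ext x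
    refine forall_congr' fun k => ?_
    constructor <;> intro h <;> linarith


end
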